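/- Fix d = 3. For every viscosity ν > 0, resistivity η > 0, and constants T > 0, M > 0, there exist a smooth divergence-free vector field b₀ : 𝕋³ → ℝ³ with zero average and ‖b₀‖_{L²} = M, and a global smooth solution (u, b, P) of the MHD system on 𝕋³ with initial datum (u(0,·), b(0,·)) = (0, b₀), such that u(t,·) and b(t,·) have zero average for all t ≥ 0 and the magnetic lines of b(0,·) and of b(T,·) are not topologically equivalent: there is no homeomorphism of 𝕋³ onto itself mapping the family of magnetic lines of b(0,·) onto the family of magnetic lines of b(T,·). -/

import Mathlib

open MeasureTheory Real Set

noncomputable section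

/-- Partial derivative of a scalar function on `ℝ^d` in the `i`-th coordinate direction. -/
def pd {d : ℕ} (i : Fin d) (f : (Fin d → ℝ) → ℝ) : (Fin d → ℝ) → ℝ :=
  fun x => fderiv ℝ f x (Pi.single i 1)

/-- Iterated partial derivative along a list of directions. -/
def pdList {d : ℕ} : List (Fin d) → ((Fin d → ℝ) → ℝ) → ((Fin d → ℝ) → ℝ)
  | [], f => f
  | i :: l, f => pd i (pdList l f)

/-- The list of directions associated to a multi-index `α`
(the direction `i` repeated `α i` times). -/
def mIdxList {d : ℕ} (α : Fin d → ℕ) : List (Fin d) :=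
  ((List.finRange d).map fun i => List.replicate (α i) i).flatten

/-- The partial derivative `∂^α f` for a multi-index `α`. -/
def pdM {d : ℕ} (α : Fin d → ℕ) (f : (Fin d → ℝ) → ℝ) : (Fin d → ℝ) → ℝ :=
  pdList (mIdxList α) f

/-- `|∇^m w|²(x) = ∑_{|α| = m} |∂^α w(x)|²` for a vector field `w : ℝ^d → ℝ^k`. -/
def gradSq {d k : ℕ} (m : ℕ) (w : (Fin d → ℝ) → Fin k → ℝ) (x : Fin d → ℝ) : ℝ :=
  ∑ α ∈ Finset.Nat.antidiagonalTuple d m, ∑ i, pdM α (fun y => w y i) x ^ 2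

/-- The fundamental domain `[0,L]^d` of the torus `ℝ^d/(Lℤ)^d`. -/
def box (d : ℕ) (L : ℝ) : Set (Fin d → ℝ) := Set.Icc 0 fun _ => L

/-- Square of the Sobolev `H^r` norm on the torus of period `L`. -/
def HnormSq {d k : ℕ} (L : ℝ) (r : ℕ) (w : (Fin d → ℝ) → Fin k → ℝ) : ℝ :=
  ∑ m ∈ Finset.range (r + 1), ∫ x in box d L, gradSq m w x

/-- The Sobolev `H^r` norm on the torus of period `L`. -/
def Hnorm {d k : ℕ} (L : ℝ) (r : ℕ) (w : (Fin d → ℝ) → Fin k → ℝ) : ℝ :=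
  Real.sqrt (HnormSq L r w)

/-- The `L²` norm on the torus of period `L`. -/
def L2norm {d k : ℕ} (L : ℝ) (w : (Fin d → ℝ) → Fin k → ℝ) : ℝ :=
  Real.sqrt (∫ x in box d L, ∑ i, w x i ^ 2)

/-- The `L^∞` norm of `∇^m w`. -/
def LinfGrad {d k : ℕ} (m : ℕ) (w : (Fin d → ℝ) → Fin k → ℝ) : ℝ :=
  ⨆ x : Fin d → ℝ, Real.sqrt (gradSq m w x)

/-- The `L^∞` norm of `w`. -/
def Linf {d k : ℕ} (w : (Fin d → ℝ) → Fin k → ℝ) : ℝ := LinfGrad 0 w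

/-- `L`-periodicity in each coordinate direction. -/
def Prdc {d : ℕ} {E : Type*} (L : ℝ) (w : (Fin d → ℝ) → E) : Prop :=
  ∀ (x : Fin d → ℝ) (i : Fin d), w (x + Pi.single i L) = w x

/-- Zero average on the torus. -/
def ZeroAvg {d k : ℕ} (L : ℝ) (w : (Fin d → ℝ) → Fin k → ℝ) : Prop :=
  ∀ i, (∫ x in box d L, w x i) = 0

/-- Divergence of a vector field on `ℝ^d`. -/
def divg {d : ℕ} (w : (Fin d → ℝ) → Fin d → ℝ) (x : Fin d → ℝ) : ℝ :=
  ∑ i, pd i (fun y => w y i) x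

/-- A smooth solution of the MHD system with viscosity `ν` and resistivity `η` on the torus
`ℝ^d/(Lℤ)^d`, on the time interval `J` (the equations are imposed at positive times of `J`). -/
structure IsMHD (d : ℕ) (L ν η : ℝ) (J : Set ℝ)
    (u b : ℝ → (Fin d → ℝ) → Fin d → ℝ) (P : ℝ → (Fin d → ℝ) → ℝ) : Prop where
  smooth_u : ContDiffOn ℝ (⊤ : ℕ∞) (fun p : ℝ × (Fin d → ℝ) => u p.1 p.2) (J ×ˢ Set.univ)
  smooth_b : ContDiffOn ℝ (⊤ : ℕ∞) (fun p : ℝ × (Fin d → ℝ) => b p.1 p.2) (J ×ˢ Set.univ)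
  smooth_P : ContDiffOn ℝ (⊤ : ℕ∞) (fun p : ℝ × (Fin d → ℝ) => P p.1 p.2) (J ×ˢ Set.univ)
  periodic_u : ∀ t ∈ J, Prdc L (u t)
  periodic_b : ∀ t ∈ J, Prdc L (b t)
  periodic_P : ∀ t ∈ J, Prdc L (P t)
  div_u : ∀ t ∈ J, ∀ x, divg (u t) x = 0
  div_b : ∀ t ∈ J, ∀ x, divg (b t) x = 0
  momentum : ∀ t ∈ J, 0 < t → ∀ x i,
    deriv (fun s => u s x i) t + (∑ j, u t x j * pd j (fun y => u t y i) x) + pd i (P t) x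
      = ν * (∑ j, pd j (pd j fun y => u t y i) x) + ∑ j, b t x j * pd j (fun y => b t y i) x
  induction_eq : ∀ t ∈ J, 0 < t → ∀ x i,
    deriv (fun s => b s x i) t + (∑ j, u t x j * pd j (fun y => b t y i) x)
      = (∑ j, b t x j * pd j (fun y => u t y i) x)
        + η * (∑ j, pd j (pd j fun y => b t y i) x)

/-- Projection from `ℝ^d` onto the torus `ℝ^d/(Lℤ)^d`. -/
def torusProj (d : ℕ) (L : ℝ) (x : Fin d → ℝ) : Fin d → AddCircle L :=
  fun i => (x i : AddCircle L)

/-- A magnetic line of the field `b`: the image on the torus of a maximal (hence, since the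
relevant fields are smooth and periodic, globally defined) integral curve of `b`. -/
def IsMagLine (d : ℕ) (L : ℝ) (b : (Fin d → ℝ) → Fin d → ℝ)
    (s : Set (Fin d → AddCircle L)) : Prop :=
  ∃ γ : ℝ → Fin d → ℝ, (∀ τ : ℝ, HasDerivAt γ (b (γ τ)) τ) ∧
    s = torusProj d L '' Set.range γ

/-- The families of magnetic lines of `b₁` and `b₂` are topologically equivalent: some
self-homeomorphism of the torus maps the family of magnetic lines of `b₁` bijectively onto the
family of magnetic lines of `b₂`. -/
def MagLinesEquiv (d : ℕ) (L : ℝ) (b₁ b₂ : (Fin d → ℝ) → Fin d → ℝ) : Prop :=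
  ∃ φ : (Fin d → AddCircle L) ≃ₜ (Fin d → AddCircle L),
    ∀ s : Set (Fin d → AddCircle L), IsMagLine d L b₁ s ↔ IsMagLine d L b₂ (φ '' s)


/-- The first component of the shear profile with amplitudes `α`, `β`:
the real part of `α e^{2πiz} + β e^{4πiz}`. -/
def profileRe (α β z : ℝ) : ℝ := α * cos (2 * π * z) + β * cos (4 * π * z)

/-- The second component of the shear profile with amplitudes `α`, `β`:
the imaginary part of `α e^{2πiz} + β e^{4πiz}`. -/
def profileIm (α β z : ℝ) : ℝ := α * sin (2 * π * z) + β * sin (4 * π * z)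

/-- The shear profile as a field in `ℝ³` depending only on the last coordinate. -/
def profile (α β z : ℝ) : Fin 3 → ℝ := ![profileRe α β z, profileIm α β z, 0]

lemma hasDerivAt_cos_const_mul (k z : ℝ) :
    HasDerivAt (fun z => cos (k * z)) (-(k * sin (k * z))) z := by
  refine ((hasDerivAt_id' z).const_mul k).cos.congr_deriv ?_
  ring

lemma hasDerivAt_sin_const_mul (k z : ℝ) :
    HasDerivAt (fun z => sin (k * z)) (k * cos (k * z)) z := by
  refine ((hasDerivAt_id' z).const_mul k).sin.congr_deriv ?_
  ring

lemma hasDerivAt_profileRe (α β z : ℝ) :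
    HasDerivAt (profileRe α β) (-profileIm (2 * π * α) (4 * π * β) z) z := by
  refine HasDerivAt.congr_deriv (f := profileRe α β)
    (((hasDerivAt_cos_const_mul (2 * π) z).const_mul α).add
      ((hasDerivAt_cos_const_mul (4 * π) z).const_mul β)) ?_
  simp only [profileIm]; ring

lemma hasDerivAt_profileIm (α β z : ℝ) :
    HasDerivAt (profileIm α β) (profileRe (2 * π * α) (4 * π * β) z) z := by
  refine HasDerivAt.congr_deriv (f := profileIm α β)
    (((hasDerivAt_sin_const_mul (2 * π) z).const_mul α).add
      ((hasDerivAt_sin_const_mul (4 * π) z).const_mul β)) ?_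
  simp only [profileRe]; ring

lemma pd_comp_apply {d : ℕ} (i j : Fin d) {F F' : ℝ → ℝ} (hF : ∀ z, HasDerivAt F (F' z) z) :
    pd j (fun y : Fin d → ℝ => F (y i)) = fun y => if j = i then F' (y i) else 0 := by
  funext x
  have h := (hF (x i)).comp_hasFDerivAt x
    (ContinuousLinearMap.proj (R := ℝ) (φ := fun _ : Fin d => ℝ) i).hasFDerivAt
  have h' : HasFDerivAt (fun y : Fin d → ℝ => F (y i)) _ x := h
  rw [pd, h'.fderiv]
  by_cases hj : j = i
  · subst hj; simp
  · simp [hj, Ne.symm hj]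

lemma pd_const {d : ℕ} (j : Fin d) (c : ℝ) : pd j (fun _ : Fin d → ℝ => c) = fun _ => 0 := by
  funext x; simp [pd]

lemma pd_profileRe (j : Fin 3) (α β : ℝ) :
    pd j (fun y : Fin 3 → ℝ => profileRe α β (y 2))
      = fun y => if j = 2 then -profileIm (2 * π * α) (4 * π * β) (y 2) else 0 :=
  pd_comp_apply 2 j (hasDerivAt_profileRe α β)

lemma pd_profileIm (j : Fin 3) (α β : ℝ) :
    pd j (fun y : Fin 3 → ℝ => profileIm α β (y 2))
      = fun y => if j = 2 then profileRe (2 * π * α) (4 * π * β) (y 2) else 0 :=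
  pd_comp_apply 2 j (hasDerivAt_profileIm α β)

lemma pd_pd_profileRe (α β : ℝ) :
    pd 2 (pd 2 fun y : Fin 3 → ℝ => profileRe α β (y 2))
      = fun y => -(profileRe ((2 * π) ^ 2 * α) ((4 * π) ^ 2 * β) (y 2)) := by
  simp only [pd_profileRe, if_true]
  rw [pd_comp_apply 2 2 (F := fun z => -profileIm _ _ z)
    (fun z => (hasDerivAt_profileIm _ _ z).neg)]
  funext y; simp only [if_true, profileRe]; ring

lemma pd_pd_profileIm (α β : ℝ) :
    pd 2 (pd 2 fun y : Fin 3 → ℝ => profileIm α β (y 2))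
      = fun y => -(profileIm ((2 * π) ^ 2 * α) ((4 * π) ^ 2 * β) (y 2)) := by
  simp only [pd_profileIm, if_true]
  rw [pd_comp_apply 2 2 (fun z => hasDerivAt_profileRe _ _ z)]
  funext y; simp only [if_true, profileIm]; ring

lemma box_one_eq_pi (d : ℕ) : box d 1 = Set.univ.pi fun _ : Fin d => Set.Icc (0 : ℝ) 1 := by
  rw [Set.pi_univ_Icc]; rfl

lemma setIntegral_box_comp_apply {d : ℕ} (i : Fin d) {F : ℝ → ℝ} (hF : Continuous F) :
    ∫ x in box d 1, F (x i) = ∫ z in (0 : ℝ)..1, F z := by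
  have hp : IsProbabilityMeasure ((volume : Measure ℝ).restrict (Set.Icc 0 1)) :=
    ⟨by simp⟩
  rw [box_one_eq_pi, volume_pi, Measure.restrict_pi_pi,
    intervalIntegral.integral_of_le zero_le_one, ← integral_Icc_eq_integral_Ioc]
  have h := measurePreserving_eval
    (fun _ : Fin d => (volume : Measure ℝ).restrict (Set.Icc 0 1)) i
  conv_rhs => rw [← h.map_eq]
  exact (integral_map h.measurable.aemeasurable hF.aestronglyMeasurable).symm

lemma continuous_profileRe (α β : ℝ) : Continuous (profileRe α β) := by
  unfold profileRe; fun_prop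

lemma continuous_profileIm (α β : ℝ) : Continuous (profileIm α β) := by
  unfold profileIm; fun_prop

lemma profileRe_add_one (α β z : ℝ) : profileRe α β (z + 1) = profileRe α β z := by
  have h2 : cos (2 * π * (z + 1)) = cos (2 * π * z) := by
    rw [mul_add, mul_one, cos_add_two_pi]
  have h4 : cos (4 * π * (z + 1)) = cos (4 * π * z) := by
    rw [show 4 * π * (z + 1) = 4 * π * z + 2 * π + 2 * π by ring, cos_add_two_pi,
      cos_add_two_pi]
  simp only [profileRe, h2, h4]

lemma profileIm_add_one (α β z : ℝ) : profileIm α β (z + 1) = profileIm α β z := by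
  have h2 : sin (2 * π * (z + 1)) = sin (2 * π * z) := by
    rw [mul_add, mul_one, sin_add_two_pi]
  have h4 : sin (4 * π * (z + 1)) = sin (4 * π * z) := by
    rw [show 4 * π * (z + 1) = 4 * π * z + 2 * π + 2 * π by ring, sin_add_two_pi,
      sin_add_two_pi]
  simp only [profileIm, h2, h4]

lemma profile_add_one (α β z : ℝ) : profile α β (z + 1) = profile α β z := by
  simp only [profile, profileRe_add_one, profileIm_add_one]

lemma intervalIntegral_profileRe (α β : ℝ) : ∫ z in (0 : ℝ)..1, profileRe α β z = 0 := by
  have hd : ∀ z, HasDerivAt (profileIm (α / (2 * π)) (β / (4 * π))) (profileRe α β z) z := by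
    intro z
    have h := hasDerivAt_profileIm (α / (2 * π)) (β / (4 * π)) z
    rwa [mul_div_cancel₀ α (by positivity), mul_div_cancel₀ β (by positivity)] at h
  rw [intervalIntegral.integral_eq_sub_of_hasDerivAt (fun z _ => hd z)
    ((continuous_profileRe α β).intervalIntegrable _ _), sub_eq_zero]
  simpa using profileIm_add_one (α / (2 * π)) (β / (4 * π)) 0

lemma intervalIntegral_profileIm (α β : ℝ) : ∫ z in (0 : ℝ)..1, profileIm α β z = 0 := by
  have hd : ∀ z, HasDerivAt (profileRe (-α / (2 * π)) (-β / (4 * π))) (profileIm α β z) z := by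
    intro z
    have h := hasDerivAt_profileRe (-α / (2 * π)) (-β / (4 * π)) z
    rw [mul_div_cancel₀ (-α) (by positivity), mul_div_cancel₀ (-β) (by positivity)] at h
    convert h using 1
    simp only [profileIm]; ring
  rw [intervalIntegral.integral_eq_sub_of_hasDerivAt (fun z _ => hd z)
    ((continuous_profileIm α β).intervalIntegrable _ _), sub_eq_zero]
  simpa using profileRe_add_one (-α / (2 * π)) (-β / (4 * π)) 0

lemma zeroAvg_profile (α β : ℝ) : ZeroAvg 1 fun x : Fin 3 → ℝ => profile α β (x 2) := by
  intro i
  fin_cases i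
  · exact (setIntegral_box_comp_apply 2 (continuous_profileRe α β)).trans
      (intervalIntegral_profileRe α β)
  · exact (setIntegral_box_comp_apply 2 (continuous_profileIm α β)).trans
      (intervalIntegral_profileIm α β)
  · simp [profile]

lemma profile_sq (α β z : ℝ) :
    profileRe α β z ^ 2 + profileIm α β z ^ 2
      = α ^ 2 + β ^ 2 + profileRe (2 * α * β) 0 z := by
  have h : cos (2 * π * z)
      = cos (4 * π * z) * cos (2 * π * z) + sin (4 * π * z) * sin (2 * π * z) := by
    rw [← cos_sub]; ring_nf
  simp only [profileRe, profileIm]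
  linear_combination α ^ 2 * sin_sq_add_cos_sq (2 * π * z)
    + β ^ 2 * sin_sq_add_cos_sq (4 * π * z) - 2 * α * β * h

lemma L2norm_profile (α β : ℝ) :
    L2norm 1 (fun x : Fin 3 → ℝ => profile α β (x 2)) = √(α ^ 2 + β ^ 2) := by
  have h : (fun x : Fin 3 → ℝ => ∑ i, profile α β (x 2) i ^ 2)
      = fun x => α ^ 2 + β ^ 2 + profileRe (2 * α * β) 0 (x 2) := by
    funext x
    rw [← profile_sq]
    simp [Fin.sum_univ_three, profile]
  have hc := continuous_profileRe (2 * α * β) 0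
  rw [L2norm, h, setIntegral_box_comp_apply 2 (F := fun z => α ^ 2 + β ^ 2 +
      profileRe (2 * α * β) 0 z) (by fun_prop),
    intervalIntegral.integral_add (by simp) (hc.intervalIntegrable _ _),
    intervalIntegral_profileRe]
  simp

/-- A shear profile with distinct positive amplitudes has no zero. -/
lemma not_profile_eq_zero {α β : ℝ} (hα : 0 < α) (hβ : 0 < β) (hne : α ≠ β) (z : ℝ)
    (hre : profileRe α β z = 0) (him : profileIm α β z = 0) : False := by
  have h := profile_sq α β z
  rw [hre, him] at h
  simp only [profileRe] at h
  have h1 : 0 < (α - β) ^ 2 := by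
    have := sub_ne_zero.mpr hne
    positivity
  nlinarith [neg_one_le_cos (2 * π * z), mul_pos hα hβ]

/-- A shear profile with equal amplitudes vanishes on the plane `z = 1 / 2`. -/
lemma profile_self_half (α : ℝ) : profile α α (1 / 2) = 0 := by
  have h2 : 2 * π * (1 / 2) = π := by ring
  have h4 : 4 * π * (1 / 2) = 2 * π := by ring
  simp [profile, profileRe, profileIm, -one_div, h2, h4]

lemma contDiff_profile {α β : ℝ → ℝ} (hα : ContDiff ℝ (⊤ : ℕ∞) α)
    (hβ : ContDiff ℝ (⊤ : ℕ∞) β) :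
    ContDiff ℝ (⊤ : ℕ∞)
      fun p : ℝ × (Fin 3 → ℝ) => profile (α p.1) (β p.1) (p.2 2) := by
  rw [contDiff_pi]
  intro i
  fin_cases i <;> simp [profile, profileRe, profileIm] <;> fun_prop

/-- Shear fields have no nonlinear interaction, so that they solve the MHD system with zero
velocity and pressure as soon as their amplitudes solve the heat equation mode by mode. -/
lemma isMHD_profile (ν η : ℝ) {J : Set ℝ} {α β : ℝ → ℝ} (hα : ContDiff ℝ (⊤ : ℕ∞) α)
    (hβ : ContDiff ℝ (⊤ : ℕ∞) β)
    (hα' : ∀ t, HasDerivAt α (-(η * ((2 * π) ^ 2 * α t))) t)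
    (hβ' : ∀ t, HasDerivAt β (-(η * ((4 * π) ^ 2 * β t))) t) :
    IsMHD 3 1 ν η J (fun _ _ => 0) (fun t x => profile (α t) (β t) (x 2)) (fun _ _ => 0) where
  smooth_u := contDiffOn_const
  smooth_b := (contDiff_profile hα hβ).contDiffOn
  smooth_P := contDiffOn_const
  periodic_u _ _ _ _ := rfl
  periodic_b t _ x i := by
    fin_cases i
    · simp
    · simp
    · simpa using profile_add_one (α t) (β t) (x 2)
  periodic_P _ _ _ _ := rfl
  div_u _ _ x := by simp [divg, pd_const]
  div_b t _ x := by
    simp [divg, Fin.sum_univ_three, profile, pd_profileRe, pd_profileIm, pd_const]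
  momentum t _ _ x i := by
    fin_cases i <;>
      simp [profile, pd_profileRe, pd_profileIm, pd_const]
  induction_eq t _ _ x i := by
    fin_cases i
    · have h : HasDerivAt (fun s => profileRe (α s) (β s) (x 2)) _ t :=
        ((hα' t).mul_const (cos (2 * π * x 2))).add ((hβ' t).mul_const (cos (4 * π * x 2)))
      have h0 : pd (0 : Fin 3) (pd 0 fun y => profileRe (α t) (β t) (y 2)) x = 0 := by
        simp [pd_profileRe, pd_const]
      have h1 : pd (1 : Fin 3) (pd 1 fun y => profileRe (α t) (β t) (y 2)) x = 0 := by
        simp [pd_profileRe, pd_const]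
      simp only [Fin.sum_univ_three, profile, Fin.zero_eta, Matrix.cons_val_zero, h.deriv,
        pd_pd_profileRe, h0, h1]
      simp [profileRe, pd_const]
      ring
    · have h : HasDerivAt (fun s => profileIm (α s) (β s) (x 2)) _ t :=
        ((hα' t).mul_const (sin (2 * π * x 2))).add ((hβ' t).mul_const (sin (4 * π * x 2)))
      have h0 : pd (0 : Fin 3) (pd 0 fun y => profileIm (α t) (β t) (y 2)) x = 0 := by
        simp [pd_profileIm, pd_const]
      have h1 : pd (1 : Fin 3) (pd 1 fun y => profileIm (α t) (β t) (y 2)) x = 0 := by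
        simp [pd_profileIm, pd_const]
      simp only [Fin.sum_univ_three, profile, Fin.mk_one, Matrix.cons_val_one,
        Matrix.cons_val_zero, h.deriv, pd_pd_profileIm, h0, h1]
      simp [profileIm, pd_const]
      ring
    · simp [profile, pd_const]

lemma isMagLine_singleton {d : ℕ} {L : ℝ} {b : (Fin d → ℝ) → Fin d → ℝ} {x : Fin d → ℝ}
    (hx : b x = 0) : IsMagLine d L b {torusProj d L x} := by
  refine ⟨fun _ => x, fun τ => ?_, by simp⟩
  rw [hx]
  exact hasDerivAt_const τ x

/-- A function with constant derivative and constant projection to the circle is constant. -/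
lemma eq_zero_of_hasDerivAt_of_coe_eq {g : ℝ → ℝ} {v : ℝ} {q : AddCircle (1 : ℝ)}
    (hg : ∀ τ, HasDerivAt g v τ) (hq : ∀ τ, (g τ : AddCircle (1 : ℝ)) = q) : v = 0 := by
  by_contra hv
  have hd : ∀ τ, HasDerivAt (fun τ => g τ - v * τ) 0 τ := fun τ => by
    refine ((hg τ).sub ((hasDerivAt_id' τ).const_mul v)).congr_deriv ?_
    ring
  have hc := is_const_of_deriv_eq_zero (fun τ => (hd τ).differentiableAt)
    (fun τ => (hd τ).deriv) (1 / (2 * v)) 0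
  have hc' : g (1 / (2 * v)) - g 0 = 1 / 2 := by
    have : v * (1 / (2 * v)) = 1 / 2 := by field_simp
    simp only [this] at hc
    linarith
  have h0 : ((g (1 / (2 * v)) - g 0 : ℝ) : AddCircle (1 : ℝ)) = 0 := by
    rw [AddCircle.coe_sub, hq, hq, sub_self]
  rw [hc', AddCircle.coe_eq_zero_iff] at h0
  obtain ⟨n, hn⟩ := h0
  rw [zsmul_eq_mul, mul_one] at hn
  have h2 : ((2 * n : ℤ) : ℝ) = ((1 : ℤ) : ℝ) := by push_cast; linarith
  have h3 : 2 * n = 1 := by exact_mod_cast h2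
  omega

/-- A magnetic line of a shear profile is reduced to a point only where the profile vanishes. -/
lemma exists_profile_eq_zero_of_isMagLine_singleton {α β : ℝ} {p : Fin 3 → AddCircle (1 : ℝ)}
    (h : IsMagLine 3 1 (fun x => profile α β (x 2)) {p}) :
    ∃ z, profileRe α β z = 0 ∧ profileIm α β z = 0 := by
  obtain ⟨γ, hγ, hp⟩ := h
  have hd : ∀ i τ, HasDerivAt (fun τ => γ τ i) (profile α β (γ τ 2) i) τ :=
    fun i τ => hasDerivAt_pi.mp (hγ τ) i
  have hproj : ∀ i τ, (γ τ i : AddCircle (1 : ℝ)) = p i := fun i τ => by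
    have hmem : torusProj 3 1 (γ τ) ∈ ({p} : Set (Fin 3 → AddCircle (1 : ℝ))) :=
      hp ▸ ⟨γ τ, ⟨τ, rfl⟩, rfl⟩
    exact congrFun hmem i
  have hz : ∀ τ, γ τ 2 = γ 0 2 := fun τ =>
    is_const_of_deriv_eq_zero (fun τ => (hd 2 τ).differentiableAt)
      (fun τ => by rw [(hd 2 τ).deriv]; simp [profile]) τ 0
  have hv : ∀ i, profile α β (γ 0 2) i = 0 := fun i =>
    eq_zero_of_hasDerivAt_of_coe_eq (fun τ => hz τ ▸ hd i τ) (hproj i)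
  exact ⟨γ 0 2, hv 0, hv 1⟩

lemma not_magLinesEquiv_profile {α β : ℝ} (hα : 0 < α) (hβ : 0 < β) (hne : α ≠ β) (δ : ℝ) :
    ¬ MagLinesEquiv 3 1 (fun x => profile α β (x 2)) (fun x => profile δ δ (x 2)) := by
  rintro ⟨φ, hφ⟩
  have h : IsMagLine 3 1 (fun x => profile δ δ (x 2)) {torusProj 3 1 fun _ => 1 / 2} :=
    isMagLine_singleton (profile_self_half δ)
  have h' := (hφ {φ.symm (torusProj 3 1 fun _ => 1 / 2)}).mpr (by simpa using h)
  obtain ⟨z, hre, him⟩ := exists_profile_eq_zero_of_isMagLine_singleton h'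
  exact not_profile_eq_zero hα hβ hne z hre him

lemma hasDerivAt_const_mul_exp (c k s t : ℝ) :
    HasDerivAt (fun t => c * exp (k * (s - t))) (-(k * (c * exp (k * (s - t))))) t := by
  refine ((((hasDerivAt_id' t).const_sub s).const_mul k).exp.const_mul c).congr_deriv ?_
  ring

/-- magnetic reconnection in 3D, Theorem 1.1 of the paper for `d = 3`.
For any viscosity `ν > 0`, resistivity `η > 0` and constants `T, M > 0` there are a smooth
zero-average divergence-free initial magnetic field `b₀` with `‖b₀‖_{L²} = M` and a global
smooth zero-average solution `(u, b, P)` of the MHD system on `𝕋³ = ℝ³/ℤ³` with initial datum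
`(0, b₀)` whose magnetic lines at times `0` and `T` are not topologically equivalent. -/
theorem magnetic_reconnection_3d (ν η T M : ℝ)
    (hν : 0 < ν) (hη : 0 < η) (hT : 0 < T) (hM : 0 < M) :
    ∃ (u b : ℝ → (Fin 3 → ℝ) → Fin 3 → ℝ) (P : ℝ → (Fin 3 → ℝ) → ℝ),
      IsMHD 3 1 ν η (Set.Ici 0) u b P ∧
      ContDiff ℝ (⊤ : ℕ∞) (b 0) ∧
      (∀ x, u 0 x = 0) ∧
      L2norm 1 (b 0) = M ∧
      (∀ t : ℝ, 0 ≤ t → ZeroAvg 1 (u t) ∧ ZeroAvg 1 (b t)) ∧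
      ¬ MagLinesEquiv 3 1 (b 0) (b T) := by
  set ka : ℝ := η * (2 * π) ^ 2
  set kb : ℝ := η * (4 * π) ^ 2
  have hk : ka < kb := by
    have : kb - ka = 12 * (η * π ^ 2) := by simp only [ka, kb]; ring
    have : 0 < η * π ^ 2 := by positivity
    linarith
  set N : ℝ := √(exp (ka * T) ^ 2 + exp (kb * T) ^ 2)
  have hN : 0 < N := by positivity
  set α : ℝ → ℝ := fun t => M / N * exp (ka * (T - t)) with hα
  set β : ℝ → ℝ := fun t => M / N * exp (kb * (T - t)) with hβ
  have hMN : 0 < M / N := by positivity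
  refine ⟨fun _ _ => 0, fun t x => profile (α t) (β t) (x 2), fun _ _ => 0, ?_, ?_,
    fun _ => rfl, ?_, fun t _ => ⟨fun i => by simp, zeroAvg_profile _ _⟩, ?_⟩
  · refine isMHD_profile ν η (by fun_prop) (by fun_prop) (fun t => ?_) (fun t => ?_)
    · convert hasDerivAt_const_mul_exp (M / N) ka T t using 1
      simp only [hα, ka]; ring
    · convert hasDerivAt_const_mul_exp (M / N) kb T t using 1
      simp only [hβ, kb]; ring
  · exact (contDiff_profile (α := α) (β := β) (by fun_prop) (by fun_prop)).comp
      (contDiff_const (c := (0 : ℝ)) |>.prodMk contDiff_id)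
  · rw [L2norm_profile]
    have h : α 0 ^ 2 + β 0 ^ 2 = (M / N * N) ^ 2 := by
      simp only [hα, hβ, sub_zero]
      rw [mul_pow _ N, Real.sq_sqrt (by positivity)]
      ring
    rw [h, Real.sqrt_sq (by positivity), div_mul_cancel₀ _ hN.ne']
  · have hT' : β T = α T := by simp [hα, hβ]
    simp only [hT']
    refine not_magLinesEquiv_profile (by positivity) (by positivity) (fun h => ?_) _
    have h1 : exp (ka * (T - 0)) = exp (kb * (T - 0)) := mul_left_cancel₀ hMN.ne' h
    have h2 := Real.exp_injective h1
    rw [sub_zero] at h2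
    exact hk.ne (mul_right_cancel₀ hT.ne' h2)

end
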